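/- Let f, g ∈ F_q[x] with deg f = k ≥ 1 and deg g = D ≥ 2, and suppose the pair (f,g) is neither critical nor p-critical. Let d > 1 be the degree of the p-reduction of g. Then there exists a real constant c > 0 such that for every n ≥ 0, either N_{f,g}(n) ≥ c·d^{n/2} or Δ_{f,g}(n) ≥ c·d^{n/2}·N_{f,g}(n) (i.e., the average degree A_{f,g}(n) = Δ_{f,g}(n)/N_{f,g}(n) is at least c·d^{n/2}). -/

import Mathlib

open Polynomial UniqueFactorizationMonoid
open scoped Classical

/-- The `n`-th compositional iterate of a polynomial `g`. -/
noncomputable def iterPoly {K : Type*} [CommSemiring K] (g : Polynomial K) : ℕ → Polynomial K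
  | 0 => X
  | n + 1 => g.comp (iterPoly g n)

/-- `P_n[f,g] = f(g^{(n)})`. -/
noncomputable def Pn {K : Type*} [CommSemiring K] (f g : Polynomial K) (n : ℕ) : Polynomial K :=
  f.comp (iterPoly g n)

/-- The finset of (normalized) monic irreducible factors of `P`. -/
noncomputable def irrFactors {K : Type*} [Field K] (P : Polynomial K) : Finset (Polynomial K) :=
  (normalizedFactors P).toFinset

/-- Number of distinct irreducible factors of `P`. -/
noncomputable def Nfac {K : Type*} [Field K] (P : Polynomial K) : ℕ := (irrFactors P).card

/-- Degree of the squarefree part of `P`. -/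
noncomputable def Dfac {K : Type*} [Field K] (P : Polynomial K) : ℕ :=
  ∑ r ∈ irrFactors P, r.natDegree

/-- Largest degree of an irreducible factor of `P`. -/
noncomputable def Mfac {K : Type*} [Field K] (P : Polynomial K) : ℕ :=
  (irrFactors P).sup natDegree

/-- Smallest degree of an irreducible factor of `P`. -/
noncomputable def mfac {K : Type*} [Field K] (P : Polynomial K) : ℕ :=
  sInf {d | ∃ r ∈ irrFactors P, r.natDegree = d}

/-- Largest multiplicity in the irreducible factorization of `P`. -/
noncomputable def Efac {K : Type*} [Field K] (P : Polynomial K) : ℕ :=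
  (irrFactors P).sup fun r => (normalizedFactors P).count r

/-- Smallest multiplicity in the irreducible factorization of `P`. -/
noncomputable def efac {K : Type*} [Field K] (P : Polynomial K) : ℕ :=
  sInf {e | ∃ r ∈ irrFactors P, (normalizedFactors P).count r = e}

/-- Largest multiplicity of a root of `P` in an algebraic closure. -/
noncomputable def nuMax {K : Type*} [Field K] (P : Polynomial K) : ℕ :=
  Efac (P.map (algebraMap K (AlgebraicClosure K)))

/-- Smallest multiplicity of a root of `P` in an algebraic closure. -/
noncomputable def nuMin {K : Type*} [Field K] (P : Polynomial K) : ℕ :=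
  efac (P.map (algebraMap K (AlgebraicClosure K)))

/-- The pair `(f, g)` is `p`-critical: `g = a x^{p^h} + b`. -/
def IsPCritical {K : Type*} [Field K] (p : ℕ) (_f g : Polynomial K) : Prop :=
  ∃ (h : ℕ) (a b : K), g = C a * X ^ p ^ h + C b

/-- The pair `(f, g)` is critical: `f = β (x-α)^{deg f}` and `g = γ (x-α)^{deg g} + α`. -/
def IsCritical {K : Type*} [Field K] (f g : Polynomial K) : Prop :=
  ∃ α β γ : K, f = C β * (X - C α) ^ f.natDegree ∧
    g = C γ * (X - C α) ^ g.natDegree + C α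

/-- The total defect of the fibres of `F` over a finite set `Y` is at most `deg F - 1` when `F` has
nonzero derivative. -/
theorem natDegree_mul_card_lt_card_fibers {L : Type*} [Field L] [IsAlgClosed L] (F : L[X])
    (hF : derivative F ≠ 0) (Y : Finset L) :
    F.natDegree * Y.card + 1 ≤
      (Y.biUnion fun y => (F - C y).roots.toFinset).card + F.natDegree := by
  have hdisj : (Y : Set L).PairwiseDisjoint fun y => (F - C y).roots.toFinset := by
    intro y _ z _ hyz
    refine Finset.disjoint_left.2 fun x hx hx' => hyz ?_
    simp only [Multiset.mem_toFinset, mem_roots', IsRoot.def, eval_sub, eval_C] at hx hx'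
    exact (sub_eq_zero.1 hx.2).symm.trans (sub_eq_zero.1 hx'.2)
  have hfib : ∀ y ∈ Y, F.natDegree ≤
      ∑ x ∈ (F - C y).roots.toFinset, (1 + (derivative F).roots.count x) := by
    intro y _
    calc F.natDegree = (F - C y).natDegree := (natDegree_sub_C).symm
      _ = (F - C y).roots.card := (IsAlgClosed.splits _).natDegree_eq_card_roots
      _ = ∑ x ∈ (F - C y).roots.toFinset, (F - C y).roots.count x :=
        (Multiset.toFinset_sum_count_eq _).symm
      _ ≤ _ := Finset.sum_le_sum fun x _ => by
        have := rootMultiplicity_sub_one_le_derivative_rootMultiplicity_of_ne_zero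
          (F - C y) x (by simpa using hF)
        simp only [derivative_sub, derivative_C, sub_zero] at this
        rw [count_roots, count_roots]
        omega
  have hsum := Finset.sum_le_sum hfib
  rw [← Finset.sum_biUnion hdisj, Finset.sum_add_distrib] at hsum
  have hcount : ∑ x ∈ Y.biUnion fun y => (F - C y).roots.toFinset,
      (derivative F).roots.count x ≤ (derivative F).natDegree := by
    refine le_trans ?_ (card_roots' _)
    rw [← Multiset.toFinset_sum_count_eq]
    exact Finset.sum_le_sum_of_ne_zero fun x _ hx =>
      Multiset.mem_toFinset.2 (Multiset.count_ne_zero.1 hx)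
  have hdeg : (derivative F).natDegree < F.natDegree :=
    natDegree_derivative_lt fun h0 => hF (derivative_of_natDegree_zero h0)
  simp only [Finset.sum_const, smul_eq_mul, mul_one] at hsum
  rw [mul_comm]
  omega

theorem natDegree_mul_card_lt_card_fibers_pow {L : Type*} [Field L] [IsAlgClosed L] (p : ℕ)
    [Fact p.Prime] [CharP L p] (h : ℕ) (F : L[X]) (hF : derivative F ≠ 0) (Y : Finset L) :
    F.natDegree * Y.card + 1 ≤
      (Y.biUnion fun y => (F ^ p ^ h - C y).roots.toFinset).card + F.natDegree := by
  have hq : p ^ h ≠ 0 := pow_ne_zero _ (Fact.out : p.Prime).ne_zero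
  have hF0 : F.natDegree ≠ 0 := fun h0 => hF (derivative_of_natDegree_zero h0)
  have hne : ∀ (P : L[X]) (y : L), P.natDegree ≠ 0 → P - C y ≠ 0 := by
    intro P y hP h0
    rw [← natDegree_sub_C (p := P) (a := y), h0, natDegree_zero] at hP
    exact hP rfl
  let e := iterateFrobeniusEquiv L p h
  have hfib := natDegree_mul_card_lt_card_fibers F hF (Y.map e.symm.toEquiv.toEmbedding)
  rw [Finset.card_map] at hfib
  convert hfib using 3
  ext x
  have key : ∀ y, eval x F ^ p ^ h - y = 0 ↔ eval x F - e.symm y = 0 := by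
    intro y
    rw [sub_eq_zero, sub_eq_zero, RingEquiv.eq_symm_apply]
    rfl
  simp [hne F _ hF0, hne (F ^ p ^ h) _ (by rw [natDegree_pow]; exact mul_ne_zero hq hF0), key]
  exact ⟨fun ⟨a, ha, hx⟩ => ⟨e.symm a, by simpa using ha, hx⟩,
    fun ⟨a, ha, hx⟩ => ⟨e a, ha, by simpa using hx⟩⟩

theorem eq_C_mul_X_sub_C_pow_of_roots {L : Type*} [Field L] [IsAlgClosed L] {P : L[X]} {α : L}
    (h : ∀ x, P.eval x = 0 → x = α) : P = C P.leadingCoeff * (X - C α) ^ P.natDegree := by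
  have hs := IsAlgClosed.splits P
  have hr : P.roots = Multiset.replicate P.natDegree α :=
    Multiset.eq_replicate.2 ⟨hs.natDegree_eq_card_roots.symm, fun x hx => h x (mem_roots'.1 hx).2⟩
  conv_lhs => rw [hs.eq_prod_roots, hr]
  simp

theorem mem_range_algebraMap_of_forall_aeval_eq_zero {K : Type*} [Field K] [PerfectField K]
    {P : K[X]} {α : AlgebraicClosure K} (hα : aeval α P = 0)
    (h : ∀ x : AlgebraicClosure K, aeval x P = 0 → x = α) :
    α ∈ (algebraMap K (AlgebraicClosure K)).range := by
  have hint : IsIntegral K α := Algebra.IsIntegral.isIntegral α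
  have hsep : (minpoly K α).Separable := Algebra.IsSeparable.isSeparable K α
  have hcard := card_rootSet_eq_natDegree (K := AlgebraicClosure K) hsep (IsAlgClosed.splits _)
  have hle : Fintype.card ((minpoly K α).rootSet (AlgebraicClosure K)) ≤ 1 := by
    refine Fintype.card_le_one_iff.2 fun x y => Subtype.ext ?_
    have hx : ∀ z : (minpoly K α).rootSet (AlgebraicClosure K), (z : AlgebraicClosure K) = α :=
      fun z => h _ (aeval_eq_zero_of_dvd_aeval_eq_zero (minpoly.dvd K α hα) (mem_rootSet.1 z.2).2)
    rw [hx x, hx y]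
  have hpos := minpoly.natDegree_pos hint
  refine minpoly.mem_range_of_degree_eq_one K α ?_
  rw [degree_eq_natDegree (minpoly.ne_zero hint)]
  norm_cast
  omega

theorem natDegree_iterPoly {K : Type*} [Field K] (g : K[X]) (n : ℕ) :
    (iterPoly g n).natDegree = g.natDegree ^ n := by
  induction n with
  | zero => simp [iterPoly]
  | succ n ih => rw [iterPoly, natDegree_comp, ih, pow_succ']

theorem aeval_iterPoly {K L : Type*} [Field K] [Field L] [Algebra K L] (g : K[X]) (n : ℕ) (x : L) :
    aeval x (iterPoly g n) = (fun y => aeval y g)^[n] x := by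
  induction n with
  | zero => simp [iterPoly]
  | succ n ih => rw [iterPoly, aeval_comp, ih, Function.iterate_succ_apply']

theorem aeval_Pn_succ {K L : Type*} [Field K] [Field L] [Algebra K L] (f g : K[X]) (n : ℕ)
    (x : L) : aeval x (Pn f g (n + 1)) = aeval (aeval x g) (Pn f g n) := by
  rw [Pn, Pn, aeval_comp, aeval_comp, aeval_iterPoly, aeval_iterPoly, Function.iterate_succ_apply]

theorem Pn_ne_zero {K : Type*} [Field K] {f g : K[X]} (hf : f.natDegree ≠ 0)
    (hg : g.natDegree ≠ 0) (n : ℕ) : Pn f g n ≠ 0 := by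
  intro h0
  have := congrArg natDegree h0
  rw [Pn, natDegree_comp, natDegree_iterPoly, natDegree_zero] at this
  exact mul_ne_zero hf (pow_ne_zero n hg) this

theorem card_aroots_le_Dfac {K L : Type*} [Field K] [Field L] [Algebra K L] {P : K[X]}
    (hP : P ≠ 0) : (P.aroots L).toFinset.card ≤ Dfac P := by
  have hsub : (P.aroots L).toFinset ⊆ (irrFactors P).biUnion fun r => (r.aroots L).toFinset := by
    intro x hx
    rw [Multiset.mem_toFinset, mem_aroots] at hx
    obtain ⟨u, hu⟩ := prod_normalizedFactors hP
    have h0 : aeval x (normalizedFactors P).prod = 0 := by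
      have hx2 := hx.2
      rw [← hu, map_mul, mul_eq_zero] at hx2
      exact hx2.resolve_right ((u.isUnit.map (aeval x)).ne_zero)
    rw [map_multiset_prod, Multiset.prod_eq_zero_iff, Multiset.mem_map] at h0
    obtain ⟨r, hr, hr0⟩ := h0
    simp only [Finset.mem_biUnion, Multiset.mem_toFinset, irrFactors]
    exact ⟨r, hr, mem_aroots.2 ⟨(irreducible_of_normalized_factor r hr).ne_zero, hr0⟩⟩
  refine (Finset.card_le_card hsub).trans (Finset.card_biUnion_le.trans ?_)
  refine Finset.sum_le_sum fun r _ => (Multiset.toFinset_card_le _).trans ?_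
  exact (card_roots' _).trans natDegree_map_le

/-- If `f` and `f ∘ g` have the same single root in the algebraic closure, then `(f, g)` is
critical. -/
theorem isCritical_of_single_root {K : Type*} [Field K] [PerfectField K] {f g : K[X]}
    {α : AlgebraicClosure K} (hα : aeval α f = 0)
    (hf : ∀ x : AlgebraicClosure K, aeval x f = 0 → x = α)
    (hg : ∀ x : AlgebraicClosure K, aeval x g = α → x = α) : IsCritical f g := by
  obtain ⟨a, rfl⟩ := mem_range_algebraMap_of_forall_aeval_eq_zero hα hf
  have hinj := map_injective _ (algebraMap K (AlgebraicClosure K)).injective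
  refine ⟨a, f.leadingCoeff, (g - C a).leadingCoeff, hinj ?_, hinj ?_⟩
  · have := eq_C_mul_X_sub_C_pow_of_roots (P := f.map (algebraMap K (AlgebraicClosure K)))
      fun x hx => hf x (by rwa [eval_map_algebraMap] at hx)
    rw [natDegree_map, leadingCoeff_map] at this
    simpa using this
  · have := eq_C_mul_X_sub_C_pow_of_roots (P := (g - C a).map (algebraMap K (AlgebraicClosure K)))
      (α := algebraMap K (AlgebraicClosure K) a)
      fun x hx => hg x (by
        rw [eval_map_algebraMap, map_sub, aeval_C] at hx
        exact sub_eq_zero.1 hx)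
    rw [natDegree_map, leadingCoeff_map, natDegree_sub_C, Polynomial.map_sub, map_C] at this
    rw [sub_eq_iff_eq_add] at this
    simpa using this

/-- The squarefree part of `f(g^{(n)})` has degree at least `d ^ (n - 2)`. -/
theorem pow_le_sq_mul_Dfac {K : Type*} [Field K] [PerfectField K] {p : ℕ} [Fact p.Prime]
    [CharP K p] {f g G : K[X]} {h : ℕ} (hf : f.natDegree ≠ 0) (hcrit : ¬ IsCritical f g)
    (hred : g = G ^ p ^ h) (hG : derivative G ≠ 0) (hG1 : 1 < G.natDegree) (n : ℕ) :
    G.natDegree ^ n ≤ G.natDegree ^ 2 * Dfac (Pn f g n) := by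
  let L := AlgebraicClosure K
  have : CharP L p := charP_of_injective_algebraMap (algebraMap K L).injective p
  have hg : g.natDegree ≠ 0 := by
    rw [hred, natDegree_pow]
    exact mul_ne_zero (pow_ne_zero _ (Fact.out : p.Prime).ne_zero) (by omega)
  let R : ℕ → Finset L := fun n => ((Pn f g n).aroots L).toFinset
  have hmem : ∀ n x, x ∈ R n ↔ aeval x (Pn f g n) = 0 := by
    intro n x
    simp only [R, Multiset.mem_toFinset, mem_aroots]
    exact and_iff_right (Pn_ne_zero hf hg n)
  have hsucc : ∀ n x, x ∈ R (n + 1) ↔ aeval x g ∈ R n := by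
    intro n x
    rw [hmem, hmem, aeval_Pn_succ]
  have hmap : g.map (algebraMap K L) = G.map (algebraMap K L) ^ p ^ h := by
    rw [hred, Polynomial.map_pow]
  have hder : derivative (G.map (algebraMap K L)) ≠ 0 := by
    rw [derivative_map]
    exact (Polynomial.map_ne_zero_iff (algebraMap K L).injective).2 hG
  have hfib : ∀ Y Z : Finset L, (∀ x, aeval x g ∈ Y → x ∈ Z) →
      G.natDegree * Y.card + 1 ≤ Z.card + G.natDegree := by
    intro Y Z hYZ
    have := natDegree_mul_card_lt_card_fibers_pow p h _ hder Y
    rw [← hmap, natDegree_map] at this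
    refine this.trans (Nat.add_le_add_right (Finset.card_le_card fun x hx => ?_) _)
    simp only [Finset.mem_biUnion, Multiset.mem_toFinset, mem_roots', IsRoot.def, eval_sub,
      eval_C, eval_map_algebraMap] at hx
    obtain ⟨y, hy, -, hxy⟩ := hx
    exact hYZ x (by rwa [sub_eq_zero.1 hxy])
  have hstep : ∀ n, G.natDegree * (R n).card + 1 ≤ (R (n + 1)).card + G.natDegree :=
    fun n => hfib _ _ fun x hx => (hsucc n x).2 hx
  have hmono : ∀ n, (R n).card ≤ (R (n + 1)).card := by
    intro n
    have := hstep n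
    rcases Nat.eq_zero_or_pos (R n).card with h0 | h0
    · omega
    · nlinarith
  have hR0 : 1 ≤ (R 0).card := by
    obtain ⟨x, hx⟩ := IsAlgClosed.exists_aeval_eq_zero L (Pn f g 0) (by
      rw [Pn, iterPoly, comp_X]
      exact fun hd => hf (natDegree_eq_of_degree_eq_some hd))
    exact Finset.card_pos.2 ⟨x, (hmem 0 x).2 hx⟩
  have hR2 : 2 ≤ (R 2).card := by
    by_contra! hlt
    have h01 : (R 0).card ≤ (R 1).card := hmono 0
    have h12 : (R 1).card ≤ (R 2).card := hmono 1
    obtain ⟨α, hα⟩ := Finset.card_eq_one.1 (show (R 0).card = 1 by omega)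
    obtain ⟨β, hβ⟩ := Finset.card_eq_one.1 (show (R 1).card = 1 by omega)
    obtain ⟨γ, hγ⟩ := Finset.card_eq_one.1 (show (R 2).card = 1 by omega)
    have hgα : ∀ x : L, aeval x g = α → x = β := fun x hx => by
      have := (hsucc 0 x).2 (by rw [hα, Finset.mem_singleton]; exact hx)
      rwa [hβ, Finset.mem_singleton] at this
    have hgβ : ∀ x : L, aeval x g = β → x = γ := fun x hx => by
      have := (hsucc 1 x).2 (by rw [hβ, Finset.mem_singleton]; exact hx)
      rwa [hγ, Finset.mem_singleton] at this
    by_cases hαβ : α = β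
    · subst hαβ
      have h0 : ∀ x : L, aeval x f = 0 ↔ x = α := fun x => by
        rw [← Finset.mem_singleton (b := x), ← hα, hmem, Pn, iterPoly, comp_X]
      exact hcrit (isCritical_of_single_root ((h0 α).2 rfl) (fun x => (h0 x).1) hgα)
    · have := hfib {α, β} {β, γ} fun x hx => by
        simp only [Finset.mem_insert, Finset.mem_singleton] at hx ⊢
        exact hx.imp (hgα x) (hgβ x)
      rw [Finset.card_pair hαβ] at this
      have : ({β, γ} : Finset L).card ≤ 2 := Finset.card_le_two
      omega
  have hgrow : ∀ m, G.natDegree ^ m + 1 ≤ (R (m + 2)).card := by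
    intro m
    induction m with
    | zero => simpa using hR2
    | succ m ih =>
      have h1 := hstep (m + 2)
      have h2 := Nat.mul_le_mul_left G.natDegree ih
      rw [mul_add, mul_one, ← pow_succ'] at h2
      rw [show m + 1 + 2 = m + 2 + 1 by ring]
      omega
  have hD : (R n).card ≤ Dfac (Pn f g n) := card_aroots_le_Dfac (Pn_ne_zero hf hg n)
  have hRn : G.natDegree ^ n ≤ G.natDegree ^ 2 * (R n).card := by
    rcases le_or_gt 2 n with hn | hn
    · obtain ⟨m, rfl⟩ := Nat.exists_eq_add_of_le hn
      rw [pow_add, add_comm 2 m]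
      exact Nat.mul_le_mul_left _ (by have := hgrow m; omega)
    · have h1 : 1 ≤ (R n).card := hR0.trans (monotone_nat_of_le_succ hmono (Nat.zero_le n))
      exact (Nat.pow_le_pow_right (by omega) hn.le).trans (Nat.le_mul_of_pos_right _ h1)
  exact hRn.trans (Nat.mul_le_mul_left _ hD)

theorem stmt3 {K : Type*} [Field K] [Fintype K] {p : ℕ} [Fact p.Prime] [CharP K p]
    (f g G : Polynomial K) (h k D d : ℕ)
    (hfk : f.natDegree = k) (hk : 1 ≤ k)
    (hgD : g.natDegree = D) (hD : 2 ≤ D)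
    (hcrit : ¬ IsCritical f g) (hpcrit : ¬ IsPCritical p f g)
    (hred : g = G ^ p ^ h) (hG : derivative G ≠ 0)
    (hd : G.natDegree = d) (hd1 : 1 < d) :
    ∃ c : ℝ, 0 < c ∧ ∀ n : ℕ,
      c * Real.sqrt (d : ℝ) ^ n ≤ (Nfac (Pn f g n) : ℝ) ∨
      c * Real.sqrt (d : ℝ) ^ n * (Nfac (Pn f g n) : ℝ) ≤ (Dfac (Pn f g n) : ℝ) := by
  subst hd hfk
  have hd0 : (0 : ℝ) < G.natDegree := by exact_mod_cast (by omega : 0 < G.natDegree)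
  refine ⟨(G.natDegree : ℝ)⁻¹, inv_pos.2 hd0, fun n => ?_⟩
  have key : (G.natDegree : ℝ) ^ n ≤ (G.natDegree : ℝ) ^ 2 * Dfac (Pn f g n) := by
    exact_mod_cast pow_le_sq_mul_Dfac (by omega) hcrit hred hG hd1 n
  set s : ℝ := (G.natDegree : ℝ)⁻¹ * √(G.natDegree : ℝ) ^ n with hs
  have hs0 : 0 < s := mul_pos (inv_pos.2 hd0) (pow_pos (Real.sqrt_pos.2 hd0) n)
  have hss : s * s ≤ Dfac (Pn f g n) := by
    rw [hs, mul_mul_mul_comm, ← mul_pow, Real.mul_self_sqrt hd0.le, ← mul_inv, ← sq,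
      inv_mul_le_iff₀ (pow_pos hd0 2)]
    exact key
  rcases le_or_gt s (Nfac (Pn f g n) : ℝ) with hle | hlt
  · exact Or.inl hle
  · exact Or.inr ((mul_le_mul_of_nonneg_left hlt.le hs0.le).trans hss)
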